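/- arXiv:1402.0398 — 2 statements merged into one kernel-verified Lean document; each statement's English description precedes it below -/
import Mathlib

section
/- Fix an integer r ≥ 1. There is a constant C > 0 such that for all sufficiently large N, the contribution of the minor arc to the Cauchy integral satisfies |∫ SC_r(e^{−π/(2√N) + 2πix})·e^{−2πiNx + π√N/2} dx| ≤ C·N^{r/2 + 1/4}·e^{3π√N/4}, where the integral is taken over the set of real x with 1/(4√N) ≤ |x| ≤ 1/2. -/
open scoped BigOperators
open Filter MeasureTheory

/-- An overpartition of `n`: a partition of `n` in which the first occurrence of
each part size may be overlined.  We encode it as a finite set of (distinct)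
overlined parts together with a multiset of non-overlined parts, all positive,
with total sum `n`. -/
structure Overpartition (n : ℕ) where
  overlined : Finset ℕ
  nonoverlined : Multiset ℕ
  overlined_pos : ∀ i ∈ overlined, 0 < i
  nonoverlined_pos : ∀ i ∈ nonoverlined, 0 < i
  total : (overlined.sum id) + nonoverlined.sum = n

namespace Overpartition

/-- The multiset of all parts of an overpartition. -/
def parts {n : ℕ} (p : Overpartition n) : Multiset ℕ := p.overlined.val + p.nonoverlined

/-- Dyson's rank of an overpartition: largest part minus number of parts. -/
def rank {n : ℕ} (p : Overpartition n) : ℤ :=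
  (p.parts.sup : ℤ) - (Multiset.card p.parts : ℤ)

end Overpartition

/-- The crank of a partition (given as a multiset of positive parts):
the largest part if there are no 1's, and otherwise `μ(λ) - o(λ)` where `o(λ)`
is the number of 1's and `μ(λ)` is the number of parts larger than `o(λ)`. -/
def multisetCrank (s : Multiset ℕ) : ℤ :=
  if s.count 1 = 0 then (s.sup : ℤ)
  else ((s.filter (fun part => s.count 1 < part)).card : ℤ) - (s.count 1 : ℤ)

/-- The first residual crank of an overpartition: the crank of the subpartition
consisting of the non-overlined parts. -/
def Overpartition.crank {n : ℕ} (p : Overpartition n) : ℤ := multisetCrank p.nonoverlined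

/-- `Mbar m n` is the number of overpartitions of `n` with first residual crank `m`. -/
noncomputable def Mbar (m : ℤ) (n : ℕ) : ℕ :=
  Nat.card {p : Overpartition n // p.crank = m}

/-- `Nbar m n` is the number of overpartitions of `n` with Dyson rank `m`. -/
noncomputable def Nbar (m : ℤ) (n : ℕ) : ℕ :=
  Nat.card {p : Overpartition n // p.rank = m}

/-- The `r`-th positive crank moment `M̄_r^+(N) = Σ_{m ≥ 1} m^r M̄(m,N)`. -/
noncomputable def Mplus (r N : ℕ) : ℝ :=
  ∑' m : ℕ, ((m : ℝ) + 1) ^ r * (Mbar ((m : ℤ) + 1) N : ℝ)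

/-- The `r`-th positive rank moment `N̄_r^+(N) = Σ_{m ≥ 1} m^r N̄(m,N)`. -/
noncomputable def Nplus (r N : ℕ) : ℝ :=
  ∑' m : ℕ, ((m : ℝ) + 1) ^ r * (Nbar ((m : ℤ) + 1) N : ℝ)

/-- Positive symmetrized crank moment `μ̄_r^+(n) = Σ_{m ≥ 1} C(m + ⌊(r-1)/2⌋, r) M̄(m,n)`. -/
noncomputable def mubar (r n : ℕ) : ℝ :=
  ∑' m : ℕ, (Nat.choose (m + 1 + (r - 1) / 2) r : ℝ) * (Mbar ((m : ℤ) + 1) n : ℝ)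

/-- Positive symmetrized rank moment `η̄_r^+(n) = Σ_{m ≥ 1} C(m + ⌊(r-1)/2⌋, r) N̄(m,n)`. -/
noncomputable def etabar (r n : ℕ) : ℝ :=
  ∑' m : ℕ, (Nat.choose (m + 1 + (r - 1) / 2) r : ℝ) * (Nbar ((m : ℤ) + 1) n : ℝ)

/-- The Dirichlet eta function at positive integers:
`η(1) = log 2` and `η(r) = (1 - 2^{1-r}) ζ(r)` for `r ≥ 2`. -/
noncomputable def dirichletEtaNat (r : ℕ) : ℝ :=
  if r = 1 then Real.log 2 else (1 - 2 ^ (1 - (r : ℝ))) * (riemannZeta r).re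

/-- The infinite Pochhammer symbol `(a; q)_∞ = Π_{j ≥ 0} (1 - a q^j)`. -/
noncomputable def poch (a q : ℂ) : ℂ := ∏' j : ℕ, (1 - a * q ^ j)

/-- The (integral) exponent `n²/2 + (r/2 + ρ_C(r)) n`, where `ρ_C(r) = 0` for odd `r`
and `1/2` for even `r`. -/
def eC (r n : ℕ) : ℕ := (n * n + r * n + (if r % 2 = 0 then n else 0)) / 2

/-- The (integral) exponent `n² + (r/2 + ρ_R(r)) n`, where `ρ_R(r) = 1/2` for odd `r`
and `1` for even `r`. -/
def eR (r n : ℕ) : ℕ := (2 * n * n + r * n + (if r % 2 = 1 then n else 2 * n)) / 2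

/-- `S_r(q) = Σ_{n ≥ 1} (-1)^{n+1} q^{n²/2 + (r/2 + ρ_C(r)) n} / (1 - q^n)^r`. -/
noncomputable def Sr (r : ℕ) (q : ℂ) : ℂ :=
  ∑' n : ℕ, (-1 : ℂ) ^ n * q ^ eC r (n + 1) / (1 - q ^ (n + 1)) ^ r

/-- `S̃_r(q) = Σ_{n ≥ 1} (-1)^{n+1} q^{n² + (r/2 + ρ_R(r)) n} / ((1 - q^n)^r (1 + q^n))`. -/
noncomputable def Str (r : ℕ) (q : ℂ) : ℂ :=
  ∑' n : ℕ, (-1 : ℂ) ^ n * q ^ eR r (n + 1) / ((1 - q ^ (n + 1)) ^ r * (1 + q ^ (n + 1)))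

/-- `SC_r(q) = ((-q;q)_∞/(q;q)_∞) S_r(q)`, the generating function of the positive
symmetrized crank moments. -/
noncomputable def SCr (r : ℕ) (q : ℂ) : ℂ := (poch (-q) q / poch q q) * Sr r q

/-- `SR_r(q) = 2 ((-q;q)_∞/(q;q)_∞) S̃_r(q)`, the generating function of the positive
symmetrized rank moments. -/
noncomputable def SRr (r : ℕ) (q : ℂ) : ℂ := 2 * (poch (-q) q / poch q q) * Str r q

/-- `c_r = ζ(r) (1 - 2^{1-r})`. -/
noncomputable def cconst (r : ℕ) : ℂ := riemannZeta r * (1 - 2 ^ (1 - (r : ℂ)))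

/-- `d_r = -(ζ(r-2)(1-2^{3-r})/2 + ρ_C(r) ζ(r-1)(1-2^{1-r}))`. -/
noncomputable def dconst (r : ℕ) : ℂ :=
  -(riemannZeta ((r : ℂ) - 2) * (1 - 2 ^ (3 - (r : ℂ))) / 2 +
    (if r % 2 = 0 then (1 : ℂ) / 2 else 0) * riemannZeta ((r : ℂ) - 1) * (1 - 2 ^ (1 - (r : ℂ))))

/-- `d'_r = -(ζ(r-2)(1-2^{3-r}) + (ρ_R(r)/2) ζ(r-1)(1-2^{1-r}))`. -/
noncomputable def dconst' (r : ℕ) : ℂ :=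
  -(riemannZeta ((r : ℂ) - 2) * (1 - 2 ^ (3 - (r : ℂ))) +
    (if r % 2 = 1 then (1 : ℂ) / 4 else (1 : ℂ) / 2) * riemannZeta ((r : ℂ) - 1) *
      (1 - 2 ^ (1 - (r : ℂ))))

/-- The modified Bessel function of the first kind,
`I_s(x) = Σ_{k ≥ 0} (x/2)^{2k+s} / (k! Γ(k+s+1))`. -/
noncomputable def besselI (s x : ℝ) : ℝ :=
  ∑' k : ℕ, (x / 2) ^ (2 * (k : ℝ) + s) / ((k.factorial : ℝ) * Real.Gamma ((k : ℝ) + s + 1))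

/-- The point `τ = x + i y` in the upper half plane. -/
noncomputable def mkTau (x y : ℝ) : ℂ := (x : ℂ) + (y : ℂ) * Complex.I

lemma le_of_sq_le_sq_aux {x y : ℝ} (h : x ^ 2 ≤ y ^ 2) (hy : 0 ≤ y) : x ≤ y :=
  (le_abs_self x).trans (abs_le_of_sq_le_sq h hy)

lemma aux_logdiff {z : ℂ} (hz : ‖z‖ < 1) :
    HasSum (fun j : ℕ => 2 * z ^ (2 * j + 1) / ((2 * j + 1 : ℕ) : ℂ))
      (Complex.log (1 + z) - Complex.log (1 - z)) := by
  have h := (Complex.hasSum_taylorSeries_log hz).add (Complex.hasSum_taylorSeries_neg_log hz)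
  rw [← sub_eq_add_neg] at h
  have hinj : Function.Injective (fun j : ℕ => 2 * j + 1) := by
    intro a b hab
    simp only at hab
    omega
  rw [← hinj.hasSum_iff] at h
  · convert! h using 1
    ext j
    simp only [Function.comp]
    rw [Even.neg_one_pow ⟨j + 1, by ring⟩]
    ring
  · intro x hx
    have : Even x := by
      by_contra hc
      rw [Nat.not_even_iff_odd] at hc
      obtain ⟨k, hk⟩ := hc
      exact hx ⟨k, hk.symm⟩
    rw [Odd.neg_one_pow this.add_one]
    ring

lemma aux_double_summable {q : ℂ} (hq : ‖q‖ < 1) :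
    Summable (fun p : ℕ × ℕ => 2 * (q ^ (p.1 + 1)) ^ (2 * p.2 + 1) / ((2 * p.2 + 1 : ℕ) : ℂ)) := by
  have hg : Summable (fun n : ℕ => ‖q‖ ^ n) := summable_geometric_of_lt_one (norm_nonneg _) hq
  have h2 := (hg.mul_of_nonneg hg (fun _ => by positivity) (fun _ => by positivity)).mul_left 2
  refine Summable.of_norm_bounded h2 ?_
  rintro ⟨k, j⟩
  simp only [norm_div, norm_mul, norm_pow, Complex.norm_natCast, Complex.norm_ofNat]
  rw [← pow_mul, ← pow_add]
  have h1 : ‖q‖ ^ ((k + 1) * (2 * j + 1)) ≤ ‖q‖ ^ (k + j) := by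
    apply pow_le_pow_of_le_one (norm_nonneg _) hq.le
    nlinarith [Nat.zero_le (k * j)]
  have h3 : (1 : ℝ) ≤ ((2 * j + 1 : ℕ) : ℝ) := by exact_mod_cast Nat.le_add_left 1 _
  rw [div_le_iff₀ (by linarith)]
  have h4 : 0 ≤ ‖q‖ ^ (k + j) := by positivity
  nlinarith

/-- The overpartition generating function as the exponential of a Lambert-type series. -/
lemma aux_P_eq {q : ℂ} (hq : ‖q‖ < 1) :
    poch (-q) q / poch q q =
      Complex.exp (∑' j : ℕ, 2 / ((2 * j + 1 : ℕ) : ℂ) * (q ^ (2 * j + 1) / (1 - q ^ (2 * j + 1)))) ∧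
    Summable (fun j : ℕ => 2 / ((2 * j + 1 : ℕ) : ℂ) * (q ^ (2 * j + 1) / (1 - q ^ (2 * j + 1)))) := by
  have hpow : ∀ n : ℕ, ‖q ^ (n + 1)‖ < 1 := fun n => by
    rw [norm_pow]; exact pow_lt_one₀ (norm_nonneg _) hq (by omega)
  have hsq : Summable (fun n : ℕ => q ^ (n + 1)) :=
    (summable_nat_add_iff 1).2 (summable_geometric_of_norm_lt_one hq)
  have hF : Summable (fun n : ℕ => Complex.log (1 + q ^ (n + 1))) :=
    Complex.summable_log_one_add_of_summable hsq
  have hG : Summable (fun n : ℕ => Complex.log (1 - q ^ (n + 1))) := by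
    simpa [sub_eq_add_neg] using Complex.summable_log_one_add_of_summable hsq.neg
  have h1 : poch (-q) q = Complex.exp (∑' n : ℕ, Complex.log (1 + q ^ (n + 1))) := by
    rw [Complex.cexp_tsum_eq_tprod _ hF]
    · unfold poch
      congr 1; ext n; ring
    · intro n h
      have := hpow n
      rw [show q ^ (n + 1) = -1 by linear_combination h] at this
      simp at this
  have h2 : poch q q = Complex.exp (∑' n : ℕ, Complex.log (1 - q ^ (n + 1))) := by
    rw [Complex.cexp_tsum_eq_tprod _ hG]
    · unfold poch
      congr 1; ext n; ring
    · intro n h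
      have := hpow n
      rw [show q ^ (n + 1) = 1 by linear_combination -h] at this
      simp at this
  have hd := aux_double_summable hq
  have hinner : ∀ j : ℕ, HasSum (fun k : ℕ => 2 * (q ^ (k + 1)) ^ (2 * j + 1) / ((2 * j + 1 : ℕ) : ℂ))
      (2 / ((2 * j + 1 : ℕ) : ℂ) * (q ^ (2 * j + 1) / (1 - q ^ (2 * j + 1)))) := by
    intro j
    have := ((hasSum_geometric_of_norm_lt_one (hpow (2 * j))).mul_left
      (2 / ((2 * j + 1 : ℕ) : ℂ) * q ^ (2 * j + 1)))
    convert! this using 1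
    · ext k
      rw [← pow_mul, ← pow_mul, show (k + 1) * (2 * j + 1) = (2 * j + 1) + (2 * j + 1) * k by ring,
        pow_add]
      ring
    · rw [div_eq_mul_inv (q ^ (2 * j + 1)), mul_assoc]
  constructor
  · rw [h1, h2, ← Complex.exp_sub, ← hF.tsum_sub hG]
    congr 1
    rw [← tsum_congr (fun j => (hinner j).tsum_eq),
      ← tsum_congr (fun k => (aux_logdiff (hpow k)).tsum_eq)]
    exact (Summable.tsum_comm (f := fun k j : ℕ => 2 * (q ^ (k + 1)) ^ (2 * j + 1) / ((2 * j + 1 : ℕ) : ℂ)) hd).symm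
  · have := hd.prod_symm.prod
    refine this.congr fun j => ?_
    exact (hinner j).tsum_eq

lemma aux_P_norm {q : ℂ} (hq : ‖q‖ < 1) :
    HasSum (fun j : ℕ => 2 / ((2 * j + 1 : ℕ) : ℝ) * (q ^ (2 * j + 1) / (1 - q ^ (2 * j + 1))).re)
      (Real.log ‖poch (-q) q / poch q q‖) ∧ 0 < ‖poch (-q) q / poch q q‖ := by
  obtain ⟨h1, h2⟩ := aux_P_eq hq
  rw [h1, Complex.norm_exp, Real.log_exp]
  refine ⟨?_, Real.exp_pos _⟩
  convert! Complex.hasSum_re h2.hasSum using 1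
  ext j
  rw [show (2 : ℂ) / ((2 * j + 1 : ℕ) : ℂ) = ((2 / ((2 * j + 1 : ℕ) : ℝ) : ℝ) : ℂ) by push_cast; rfl,
    Complex.re_ofReal_mul]

lemma aux_odd_sq : HasSum (fun j : ℕ => 1 / ((2 * j + 1 : ℕ) : ℝ) ^ 2) (Real.pi ^ 2 / 8) := by
  have h := hasSum_zeta_two
  have he : HasSum (fun k : ℕ => 1 / (((2 * k : ℕ) : ℝ)) ^ 2) (Real.pi ^ 2 / 24) := by
    convert! h.mul_left (1 / 4) using 1
    · ext k; push_cast
      rw [mul_pow, one_div, mul_inv]; norm_num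
    · ring
  have hs : Summable (fun j : ℕ => 1 / ((2 * j + 1 : ℕ) : ℝ) ^ 2) :=
    h.summable.comp_injective (i := fun j : ℕ => 2 * j + 1) (by intro a b hab; simp only at hab; omega)
  have := (HasSum.even_add_odd (f := fun n : ℕ => 1 / (n : ℝ) ^ 2) he hs.hasSum).unique h
  rw [show Real.pi ^ 2 / 8 = ∑' j : ℕ, 1 / ((2 * j + 1 : ℕ) : ℝ) ^ 2 by linarith]
  exact hs.hasSum

/-- For small `s` in the right half plane, `Re 1/(e^s-1) ≤ Re 1/s`. -/
lemma aux_small {s : ℂ} (hs : 0 < s.re) (hs1 : ‖s‖ ≤ 1) :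
    (1 / (Complex.exp s - 1)).re ≤ (1 / s).re := by
  have hs0 : s ≠ 0 := by rintro rfl; simp at hs
  have hb := Complex.exp_bound hs1 (n := 3) (by norm_num)
  simp only [Finset.sum_range_succ, Finset.sum_range_zero, Nat.factorial] at hb
  norm_num at hb
  set v : ℂ := (Complex.exp s - 1 - s) / s ^ 2 with hv
  have hE : Complex.exp s = 1 + s * (1 + s * v) := by rw [hv]; field_simp; ring
  have hv2 : ‖v - 1 / 2‖ ≤ 2 / 9 := by
    have : v - 1 / 2 = (Complex.exp s - (1 + s + s ^ 2 / 2)) / s ^ 2 := by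
      rw [hv]; field_simp; ring
    rw [this, norm_div, norm_pow, div_le_iff₀ (by positivity)]
    have h3 : 0 ≤ ‖s‖ ^ 2 := by positivity
    nlinarith
  have hvre : 0 ≤ v.re := by
    have := (Complex.abs_re_le_norm _).trans hv2
    rw [abs_le] at this
    have h5 := this.1
    simp at h5
    linarith
  have hne : 1 + s * v ≠ 0 := by
    intro h
    rw [h] at hE
    have : ‖Complex.exp s‖ = 1 := by rw [hE]; simp
    rw [Complex.norm_exp, Real.exp_eq_one_iff] at this
    linarith
  have key : 1 / s - 1 / (Complex.exp s - 1) = v / (1 + s * v) := by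
    rw [hE]
    rw [show 1 + s * (1 + s * v) - 1 = s * (1 + s * v) by ring]
    field_simp
    ring
  have : 0 ≤ (v / (1 + s * v)).re := by
    rw [Complex.div_re, ← add_div]
    apply div_nonneg _ (Complex.normSq_nonneg _)
    simp
    nlinarith [mul_nonneg hs.le (sq_nonneg v.re), mul_nonneg hs.le (sq_nonneg v.im)]
  rw [← key, Complex.sub_re] at this
  linarith

lemma aux_tail {b : ℝ} (hb : 0 < b) :
    Summable (fun m : ℕ => if (m : ℝ) * b ≤ 1 then (0 : ℝ) else 1 / (m : ℝ) ^ 2) ∧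
    ∑' m : ℕ, (if (m : ℝ) * b ≤ 1 then (0 : ℝ) else 1 / (m : ℝ) ^ 2) ≤ 2 * b := by
  have hnn : ∀ m : ℕ, 0 ≤ (if (m : ℝ) * b ≤ 1 then (0 : ℝ) else 1 / (m : ℝ) ^ 2) := by
    intro m; split_ifs <;> positivity
  have hsum : ∀ n : ℕ, ∑ m ∈ Finset.range n,
      (if (m : ℝ) * b ≤ 1 then (0 : ℝ) else 1 / (m : ℝ) ^ 2) ≤ 2 * b := by
    intro n
    set k := ⌊1 / b⌋₊ with hk
    have h1 : ∑ m ∈ Finset.range n, (if (m : ℝ) * b ≤ 1 then (0 : ℝ) else 1 / (m : ℝ) ^ 2)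
        ≤ ∑ m ∈ Finset.Ioo k n, ((m : ℝ) ^ 2)⁻¹ := by
      calc _ = ∑ m ∈ Finset.range n with k < m, (if (m : ℝ) * b ≤ 1 then (0 : ℝ) else 1 / (m : ℝ) ^ 2) := by
            symm
            apply Finset.sum_filter_of_ne
            intro m _ hm
            by_contra hc
            apply hm
            rw [if_pos]
            have : (m : ℝ) ≤ 1 / b := by
              refine le_trans ?_ (Nat.floor_le (by positivity : 0 ≤ 1 / b))
              exact_mod_cast not_lt.1 hc
            rwa [le_div_iff₀ hb] at this
        _ = ∑ m ∈ Finset.Ioo k n, (if (m : ℝ) * b ≤ 1 then (0 : ℝ) else 1 / (m : ℝ) ^ 2) := by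
            apply Finset.sum_congr _ (fun _ _ => rfl)
            ext m; simp; tauto
        _ ≤ _ := by
            apply Finset.sum_le_sum
            intro m _
            split_ifs
            · positivity
            · rw [one_div]
    refine h1.trans ((sum_Ioo_inv_sq_le k n).trans ?_)
    have h2 : 1 / b < k + 1 := Nat.lt_floor_add_one _
    rw [div_lt_iff₀ hb] at h2
    rw [div_le_iff₀ (by positivity)]
    linarith
  exact ⟨summable_of_sum_range_le hnn hsum, Real.tsum_le_of_sum_range_le hnn hsum⟩

lemma aux_exp_lower {u : ℝ} (hu : 0 < u) : u ^ 2 / 2 ≤ Real.exp u - 1 := by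
  have := Real.quadratic_le_exp_of_nonneg hu.le
  linarith

lemma aux_norm_exp_sub {s : ℂ} : Real.exp s.re - 1 ≤ ‖Complex.exp s - 1‖ := by
  have := norm_sub_norm_le (Complex.exp s) 1
  rwa [Complex.norm_exp, norm_one] at this

lemma aux_term_eq (t : ℂ) (m : ℕ) :
    Complex.exp (-t) ^ m / (1 - Complex.exp (-t) ^ m) = 1 / (Complex.exp (m * t) - 1) := by
  rw [← Complex.exp_nat_mul, show (m : ℂ) * -t = -(m * t) by ring, Complex.exp_neg]
  have := Complex.exp_ne_zero (m * t)
  by_cases h : Complex.exp (m * t) - 1 = 0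
  · have h' : Complex.exp (m * t) = 1 := by linear_combination h
    rw [h']; simp
  · have h2 : 1 - (Complex.exp (m * t))⁻¹ ≠ 0 := by
      intro hc
      apply h
      field_simp at hc
      simpa using hc
    field_simp

lemma aux_norm_lt_one {t : ℂ} (ht : 0 < t.re) : ‖Complex.exp (-t)‖ < 1 := by
  rw [Complex.norm_exp, Real.exp_lt_one_iff]
  simpa using ht

/-- Bound for the overpartition generating function in a sector. -/
lemma aux_regionA {t : ℂ} (ht : 0 < t.re) :
    ‖poch (-Complex.exp (-t)) (Complex.exp (-t)) / poch (Complex.exp (-t)) (Complex.exp (-t))‖ ≤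
      Real.exp (Real.pi ^ 2 / 4 * (1 / t).re + 8 * (‖t‖ / t.re) ^ 2) := by
  obtain ⟨hS, hpos⟩ := aux_P_norm (aux_norm_lt_one ht)
  rw [← Real.log_le_iff_le_exp hpos]
  have ht0 : t ≠ 0 := by rintro rfl; simp at ht
  have hn : 0 < ‖t‖ := norm_pos_iff.2 ht0
  obtain ⟨hg, hgs⟩ := aux_tail hn
  have hinj : Function.Injective (fun j : ℕ => 2 * j + 1) := by
    intro a b hab; simp only at hab; omega
  set g : ℕ → ℝ := fun m : ℕ => if (m : ℝ) * ‖t‖ ≤ 1 then (0 : ℝ) else 1 / (m : ℝ) ^ 2 with hgdef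
  have hgo : Summable (fun j : ℕ => g (2 * j + 1)) := hg.comp_injective hinj
  have hgo2 : ∑' j : ℕ, g (2 * j + 1) ≤ 2 * ‖t‖ := by
    refine le_trans ?_ hgs
    refine hgo.tsum_le_tsum_of_inj (fun j : ℕ => 2 * j + 1) hinj ?_ (fun _ => le_rfl) hg
    intro m _; simp only [hgdef]; split_ifs <;> positivity
  have hR := (aux_odd_sq.mul_left (2 * (1 / t).re)).add (hgo.hasSum.mul_left (4 * ‖t‖ / t.re ^ 2))
  refine (hasSum_le ?_ hS hR).trans ?_
  · intro j
    rw [aux_term_eq]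
    set m : ℕ := 2 * j + 1 with hm
    have hm1 : (1 : ℝ) ≤ m := by exact_mod_cast Nat.le_add_left 1 _
    have hmp : (0 : ℝ) < m := by linarith
    have hre : ((m : ℂ) * t).re = m * t.re := by simp
    have hnm : ‖(m : ℂ) * t‖ = m * ‖t‖ := by simp
    have hrep : 0 < ((m : ℂ) * t).re := by rw [hre]; positivity
    have hinvre : 0 ≤ (1 / t).re := by
      rw [one_div, Complex.inv_re]; exact div_nonneg ht.le (Complex.normSq_nonneg _)
    by_cases hc : (m : ℝ) * ‖t‖ ≤ 1
    · have h1 := aux_small hrep (by rw [hnm]; exact hc)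
      have h2 : (1 / ((m : ℂ) * t)).re = (1 / t).re / m := by
        rw [show 1 / ((m : ℂ) * t) = ((1 / (m : ℝ) : ℝ) : ℂ) * (1 / t) by push_cast; field_simp,
          Complex.re_ofReal_mul]
        ring
      simp only [hgdef, if_pos hc, mul_zero, add_zero]
      calc _ ≤ 2 / (m : ℝ) * ((1 / t).re / m) := by
            apply mul_le_mul_of_nonneg_left _ (by positivity)
            rw [← h2]; exact h1
        _ = _ := by ring
    · simp only [hgdef, if_neg hc]
      push Not at hc
      have hu : 0 < m * t.re := by positivity
      have h1 : (1 / (Complex.exp (m * t) - 1)).re ≤ 2 / (m * t.re) ^ 2 := by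
        refine (Complex.re_le_norm _).trans ?_
        rw [norm_div, norm_one]
        have h3 := aux_exp_lower hu
        have h4 := aux_norm_exp_sub (s := m * t)
        rw [hre] at h4
        calc _ ≤ 1 / ((m * t.re) ^ 2 / 2) := by
              apply one_div_le_one_div_of_le (by positivity); linarith
          _ = _ := by field_simp
      have h5 : 1 / (m : ℝ) ≤ ‖t‖ := by
        rw [div_le_iff₀ hmp]; linarith
      have h6 : 0 ≤ 2 * (1 / t).re * (1 / (m : ℝ) ^ 2) := by positivity
      calc _ ≤ 2 / (m : ℝ) * (2 / (m * t.re) ^ 2) :=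
            mul_le_mul_of_nonneg_left h1 (by positivity)
        _ = 4 / t.re ^ 2 * (1 / (m : ℝ) ^ 2) * (1 / m) := by field_simp; norm_num
        _ ≤ 4 / t.re ^ 2 * (1 / (m : ℝ) ^ 2) * ‖t‖ := mul_le_mul_of_nonneg_left h5 (by positivity)
        _ = 4 * ‖t‖ / t.re ^ 2 * (1 / (m : ℝ) ^ 2) := by ring
        _ ≤ _ := by linarith
  · have : 4 * ‖t‖ / t.re ^ 2 * ∑' j : ℕ, g (2 * j + 1) ≤ 4 * ‖t‖ / t.re ^ 2 * (2 * ‖t‖) :=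
      mul_le_mul_of_nonneg_left hgo2 (by positivity)
    have h2 : 4 * ‖t‖ / t.re ^ 2 * (2 * ‖t‖) = 8 * (‖t‖ / t.re) ^ 2 := by ring
    linarith

/-- Bound for the overpartition generating function away from the real axis. -/
lemma aux_regionB {t : ℂ} (ht : 0 < t.re) (h3 : 3 * t.re * ‖Complex.exp (-t)‖ ≤ ‖1 - Complex.exp (-t)‖) :
    ‖poch (-Complex.exp (-t)) (Complex.exp (-t)) / poch (Complex.exp (-t)) (Complex.exp (-t))‖ ≤
      Real.exp (Real.pi ^ 2 / (8 * t.re)) := by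
  obtain ⟨hS, hpos⟩ := aux_P_norm (aux_norm_lt_one ht)
  rw [← Real.log_le_iff_le_exp hpos]
  have hR := (aux_odd_sq.mul_left (2 / t.re)).update 0 (2 / (3 * t.re))
  refine (hasSum_le ?_ hS hR).trans ?_
  · intro j
    rcases Nat.eq_zero_or_pos j with rfl | hj
    · simp only [Function.update_self]
      simp only [mul_zero, zero_add, pow_one, Nat.cast_one]
      have hq : 0 < ‖Complex.exp (-t)‖ := by simp
      have : (Complex.exp (-t) / (1 - Complex.exp (-t))).re ≤ 1 / (3 * t.re) := by
        refine (Complex.re_le_norm _).trans ?_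
        rw [norm_div, div_le_div_iff₀ (lt_of_lt_of_le (by positivity) h3) (by positivity)]
        linarith
      calc _ ≤ 2 / 1 * (1 / (3 * t.re)) := mul_le_mul_of_nonneg_left this (by norm_num)
        _ = _ := by field_simp
    · rw [Function.update_of_ne hj.ne']
      rw [aux_term_eq]
      set m : ℕ := 2 * j + 1 with hm
      have hmp : (0 : ℝ) < m := by exact_mod_cast Nat.succ_pos _
      have hre : ((m : ℂ) * t).re = m * t.re := by simp
      have h1 : (1 / (Complex.exp (m * t) - 1)).re ≤ 1 / (m * t.re) := by
        refine (Complex.re_le_norm _).trans ?_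
        rw [norm_div, norm_one]
        have h4 := aux_norm_exp_sub (s := m * t)
        rw [hre] at h4
        apply one_div_le_one_div_of_le (by positivity)
        have := Real.add_one_le_exp (m * t.re)
        linarith
      calc _ ≤ 2 / (m : ℝ) * (1 / (m * t.re)) := mul_le_mul_of_nonneg_left h1 (by positivity)
        _ = _ := by field_simp
  · have hpi := Real.pi_lt_d2
    have hpi0 := Real.pi_pos
    have : Real.pi ^ 2 < 10 := by nlinarith
    simp
    have e : 2 / (3 * t.re) - 2 / t.re + 2 / t.re * (Real.pi ^ 2 / 8) =
      (Real.pi ^ 2 / 4 - 4 / 3) / t.re := by field_simp; ring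
    have e2 : Real.pi ^ 2 / (8 * t.re) = (Real.pi ^ 2 / 8) / t.re := by field_simp
    rw [e, e2]
    gcongr
    linarith

lemma aux_eC (r n : ℕ) (hr : 1 ≤ r) : ((n : ℝ) + 1) ^ 2 / 2 ≤ (eC r (n + 1) : ℝ) := by
  have h : (n + 1) * (n + 1) ≤ 2 * eC r (n + 1) := by
    unfold eC
    have : 1 ≤ r * (n + 1) := Nat.one_le_iff_ne_zero.2 (by positivity)
    omega
  have h2 : ((n : ℝ) + 1) * (n + 1) ≤ 2 * (eC r (n + 1) : ℝ) := by exact_mod_cast h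
  linarith

lemma aux_indicator {a : ℝ} (ha : 0 < a) :
    ∃ s : ℝ, s ≤ 1 / a ∧
      HasSum (fun n : ℕ => if ((n + 1 : ℕ) : ℝ) * a ≤ 1 then (1 : ℝ) else 0) s := by
  refine ⟨_, ?_, hasSum_sum_of_ne_finset_zero (s := Finset.range ⌊1 / a⌋₊) ?_⟩
  · calc _ ≤ ∑ n ∈ Finset.range ⌊1 / a⌋₊, (1 : ℝ) := by
          apply Finset.sum_le_sum; intro n _; split_ifs <;> norm_num
      _ = (⌊1 / a⌋₊ : ℝ) := by simp
      _ ≤ _ := Nat.floor_le (by positivity)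
  · intro n hn
    rw [if_neg]
    intro h
    apply hn
    rw [Finset.mem_range, ← Nat.succ_le_iff]
    apply Nat.le_floor
    rwa [le_div_iff₀ ha]

lemma aux_Sr (r : ℕ) (hr : 1 ≤ r) {q : ℂ} {σ a : ℝ} (hσ : 0 < σ) (hσ1 : σ ≤ 1)
    (hq : ‖q‖ = Real.exp (-σ)) (ha : 0 < a) (ha2 : a ^ 2 = σ / 2) :
    ‖Sr r q‖ ≤ (2 / σ) ^ r * (3 / a) := by
  obtain ⟨s, hs, hI⟩ := aux_indicator ha
  obtain ⟨hg, hgs⟩ := aux_tail ha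
  have hg1 := hg.comp_injective (i := fun n : ℕ => n + 1) (fun x y h => by simpa using h)
  have hgs1 : ∑' n : ℕ, (if ((n + 1 : ℕ) : ℝ) * a ≤ 1 then (0 : ℝ) else 1 / ((n + 1 : ℕ) : ℝ) ^ 2)
      ≤ 2 * a := by
    refine le_trans ?_ hgs
    refine hg1.tsum_le_tsum_of_inj (fun j : ℕ => j + 1) (fun x y h => by simpa using h) ?_
      (fun _ => le_rfl) hg
    intro m _; split_ifs <;> positivity
  have hR := (hI.add (hg1.hasSum.mul_left (1 / a ^ 2))).mul_left ((2 / σ) ^ r)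
  have hq1 : ‖q‖ < 1 := by rw [hq, Real.exp_lt_one_iff]; linarith
  have hlow : σ / 2 ≤ 1 - ‖q‖ := by
    rw [hq, Real.exp_neg]
    have h1 := Real.add_one_le_exp σ
    have h2 : (Real.exp σ)⁻¹ ≤ (σ + 1)⁻¹ := by
      apply inv_anti₀ (by linarith) h1
    have h3 : (σ + 1)⁻¹ ≤ 1 - σ / 2 := by
      rw [inv_le_iff_one_le_mul₀ (by linarith)]
      nlinarith
    linarith
  have hb := tsum_of_norm_bounded hR (f := fun n : ℕ =>
    (-1 : ℂ) ^ n * q ^ eC r (n + 1) / (1 - q ^ (n + 1)) ^ r) ?_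
  · refine hb.trans ?_
    apply mul_le_mul_of_nonneg_left _ (by positivity)
    have h4 : 1 / a ^ 2 * ∑' n : ℕ, (if ((n + 1 : ℕ) : ℝ) * a ≤ 1 then (0 : ℝ)
        else 1 / ((n + 1 : ℕ) : ℝ) ^ 2) ≤ 1 / a ^ 2 * (2 * a) :=
      mul_le_mul_of_nonneg_left hgs1 (by positivity)
    have h5 : 1 / a ^ 2 * (2 * a) = 2 / a := by field_simp
    have h6 : 3 / a = 1 / a + 2 / a := by ring
    rw [h6]
    rw [h5] at h4
    exact add_le_add hs h4
  · intro n
    have hden : σ / 2 ≤ ‖1 - q ^ (n + 1)‖ := by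
      have h1 := norm_sub_norm_le (1 : ℂ) (q ^ (n + 1))
      rw [norm_one, norm_pow] at h1
      have h2 : ‖q‖ ^ (n + 1) ≤ ‖q‖ := pow_le_of_le_one (norm_nonneg _) hq1.le (by omega)
      linarith
    have hnum : ‖q‖ ^ eC r (n + 1) ≤ Real.exp (-(a ^ 2 * ((n : ℝ) + 1) ^ 2)) := by
      rw [hq, ← Real.exp_nat_mul]
      apply Real.exp_le_exp.2
      have := aux_eC r n hr
      rw [ha2]
      nlinarith
    have hmain : Real.exp (-(a ^ 2 * ((n : ℝ) + 1) ^ 2)) ≤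
        (if ((n + 1 : ℕ) : ℝ) * a ≤ 1 then (1 : ℝ) else 0) +
        1 / a ^ 2 * (if ((n + 1 : ℕ) : ℝ) * a ≤ 1 then (0 : ℝ) else 1 / ((n + 1 : ℕ) : ℝ) ^ 2) := by
      split_ifs
      · simp only [mul_zero, add_zero, Real.exp_le_one_iff]
        have : 0 ≤ a ^ 2 * ((n : ℝ) + 1) ^ 2 := by positivity
        linarith
      · rw [zero_add, Real.exp_neg]
        have hu : 0 < a ^ 2 * ((n : ℝ) + 1) ^ 2 := by positivity
        calc _ ≤ (a ^ 2 * ((n : ℝ) + 1) ^ 2)⁻¹ := by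
              apply inv_anti₀ hu
              have := Real.add_one_le_exp (a ^ 2 * ((n : ℝ) + 1) ^ 2)
              linarith
          _ = _ := by push_cast; rw [mul_inv, one_div, one_div]
    rw [norm_div, norm_mul, norm_pow, norm_neg, norm_one, one_pow, one_mul, norm_pow, norm_pow]
    calc _ ≤ Real.exp (-(a ^ 2 * ((n : ℝ) + 1) ^ 2)) / (σ / 2) ^ r := by gcongr
      _ = (2 / σ) ^ r * Real.exp (-(a ^ 2 * ((n : ℝ) + 1) ^ 2)) := by
          rw [div_eq_mul_inv, ← inv_pow, inv_div]; ring
      _ ≤ _ := mul_le_mul_of_nonneg_left hmain (by positivity)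

lemma aux_one_sub {σ θ : ℝ} (hθ : |θ| ≤ Real.pi) :
    2 / Real.pi * |θ| * Real.exp (-σ) ≤ ‖1 - Complex.exp (-((σ : ℂ) - θ * Complex.I))‖ ∨ σ < 0 := by
  by_cases hσ : σ < 0
  · exact Or.inr hσ
  left
  push Not at hσ
  refine le_of_sq_le_sq_aux ?_ (norm_nonneg _)
  have hc := Real.cos_le_one_sub_mul_cos_sq hθ
  have hE : Real.exp (-σ) ≤ 1 := by rw [Real.exp_le_one_iff]; linarith
  have hE0 := Real.exp_pos (-σ)
  rw [← Complex.normSq_eq_norm_sq, Complex.normSq_apply]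
  have hre : (1 - Complex.exp (-((σ : ℂ) - θ * Complex.I))).re = 1 - Real.exp (-σ) * Real.cos θ := by
    simp [Complex.exp_re]
  have him : (1 - Complex.exp (-((σ : ℂ) - θ * Complex.I))).im = - (Real.exp (-σ) * Real.sin θ) := by
    simp [Complex.exp_im]
  rw [hre, him]
  set E := Real.exp (-σ)
  have hsc := Real.sin_sq_add_cos_sq θ
  have e1 : (2 / Real.pi * |θ| * E) ^ 2 = 2 * E ^ 2 * (2 / Real.pi ^ 2 * θ ^ 2) := by
    rw [mul_pow, mul_pow, sq_abs, div_pow]; ring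
  rw [e1]
  have hX : 0 ≤ 2 / Real.pi ^ 2 * θ ^ 2 := by positivity
  set X := 2 / Real.pi ^ 2 * θ ^ 2
  have e2 : (1 - E * Real.cos θ) * (1 - E * Real.cos θ) + -(E * Real.sin θ) * -(E * Real.sin θ)
      = (1 - E) ^ 2 + 2 * E * (1 - Real.cos θ) := by
    linear_combination E ^ 2 * hsc
  rw [e2]
  have h1 : 2 * E * X ≤ 2 * E * (1 - Real.cos θ) :=
    mul_le_mul_of_nonneg_left (by linarith) (by positivity)
  have h2 : 2 * E ^ 2 * X ≤ 2 * E * X := by nlinarith [mul_nonneg hE0.le hX]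
  nlinarith [sq_nonneg (1 - E)]

/-- Uniform bound for the overpartition generating function on the minor arc. -/
lemma aux_P_bound {σ θ : ℝ} (hσ : 0 < σ) (h1 : σ ≤ |θ|) (h2 : |θ| ≤ Real.pi) :
    ‖poch (-Complex.exp (-((σ : ℂ) - θ * Complex.I))) (Complex.exp (-((σ : ℂ) - θ * Complex.I))) /
      poch (Complex.exp (-((σ : ℂ) - θ * Complex.I))) (Complex.exp (-((σ : ℂ) - θ * Complex.I)))‖ ≤
      Real.exp (Real.pi ^ 2 / (8 * σ) + 208) := by
  have hre : ((σ : ℂ) - θ * Complex.I).re = σ := by simp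
  have him : ((σ : ℂ) - θ * Complex.I).im = -θ := by simp
  have hpi := Real.pi_pos
  by_cases hc : |θ| ≤ 5 * σ
  · refine (aux_regionA (by rw [hre]; exact hσ)).trans (Real.exp_le_exp.2 ?_)
    have hnsq : Complex.normSq ((σ : ℂ) - θ * Complex.I) = σ ^ 2 + θ ^ 2 := by
      rw [Complex.normSq_apply, hre, him]; ring
    have hθ : σ ^ 2 ≤ θ ^ 2 := by rw [← sq_abs θ]; gcongr
    have hθ2 : θ ^ 2 ≤ 25 * σ ^ 2 := by
      rw [← sq_abs θ]; nlinarith [abs_nonneg θ]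
    apply add_le_add
    · rw [one_div, Complex.inv_re, hre, hnsq]
      have : σ / (σ ^ 2 + θ ^ 2) ≤ 1 / (2 * σ) := by
        rw [div_le_div_iff₀ (by positivity) (by positivity)]
        nlinarith
      calc _ ≤ Real.pi ^ 2 / 4 * (1 / (2 * σ)) := mul_le_mul_of_nonneg_left this (by positivity)
        _ = _ := by field_simp; norm_num
    · rw [hre, div_pow, ← Complex.normSq_eq_norm_sq, hnsq]
      have : (σ ^ 2 + θ ^ 2) / σ ^ 2 ≤ 26 := by
        rw [div_le_iff₀ (by positivity)]; linarith
      linarith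
  · push Not at hc
    have hB := aux_regionB (t := (σ : ℂ) - θ * Complex.I) (by rw [hre]; exact hσ) ?_
    · refine hB.trans (Real.exp_le_exp.2 ?_)
      rw [hre]; linarith
    · rw [Complex.norm_exp, Complex.neg_re, hre]
      rcases aux_one_sub (σ := σ) h2 with h | h
      · refine le_trans ?_ h
        apply mul_le_mul_of_nonneg_right _ (Real.exp_pos _).le
        rw [div_mul_eq_mul_div, le_div_iff₀ hpi]
        nlinarith [Real.pi_lt_d2]
      · linarith

/-- The minor-arc contribution to the Cauchy integral is exponentially smaller. -/
theorem minor_arc_integral_bound (r : ℕ) (hr : 1 ≤ r) :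
    ∃ C : ℝ, 0 < C ∧ ∃ N₀ : ℕ, ∀ N : ℕ, N₀ ≤ N →
      ‖∫ x in {x : ℝ | 1 / (4 * Real.sqrt N) ≤ |x| ∧ |x| ≤ 1 / 2},
          SCr r (Complex.exp (-(Real.pi / (2 * Real.sqrt N)) + 2 * Real.pi * Complex.I * x)) *
            Complex.exp (-2 * Real.pi * Complex.I * N * x + Real.pi * Real.sqrt N / 2)‖ ≤
        C * (N : ℝ) ^ ((r : ℝ) / 2 + 1 / 4) * Real.exp (3 * Real.pi * Real.sqrt N / 4) := by
  refine ⟨2 ^ r * 6 * Real.exp 208, by positivity, 4, fun N hN => ?_⟩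
  have hNr : (4 : ℝ) ≤ N := by exact_mod_cast hN
  have hN0 : (0 : ℝ) < N := by linarith
  set w := Real.sqrt N with hw
  have hw2 : 2 ≤ w := by
    rw [hw]; apply Real.le_sqrt_of_sq_le; linarith
  have hw0 : 0 < w := by linarith
  have hpi := Real.pi_pos
  have hpi3 := Real.pi_gt_three
  have hpi4 := Real.pi_lt_d2
  set σ := Real.pi / (2 * w) with hσdef
  have hσ : 0 < σ := by positivity
  have hσ1 : σ ≤ 1 := by
    rw [hσdef, div_le_one (by positivity)]; linarith
  have hσinv : 1 / σ ≤ w := by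
    rw [hσdef, one_div_div, div_le_iff₀ hpi]; nlinarith
  have hexpo : Real.pi ^ 2 / (8 * σ) = Real.pi * w / 4 := by
    rw [hσdef]; field_simp; norm_num
  set a := Real.sqrt (σ / 2) with hadef
  have ha : 0 < a := Real.sqrt_pos.2 (by positivity)
  have ha2 : a ^ 2 = σ / 2 := Real.sq_sqrt (by positivity)
  have hwpow : w ^ r = (N : ℝ) ^ ((r : ℝ) / 2) := by
    rw [hw, Real.sqrt_eq_rpow, ← Real.rpow_natCast, ← Real.rpow_mul hN0.le]
    congr 1; ring
  have hN4 : ((N : ℝ) ^ ((1 : ℝ) / 4)) ^ 2 = w := by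
    rw [hw, Real.sqrt_eq_rpow, ← Real.rpow_natCast, ← Real.rpow_mul hN0.le]
    norm_num
  have hainv : 1 / a ≤ 2 * (N : ℝ) ^ ((1 : ℝ) / 4) := by
    refine le_of_sq_le_sq_aux ?_ (by positivity)
    rw [mul_pow, hN4, div_pow, ha2]
    calc _ = 2 * (1 / σ) := by field_simp
      _ ≤ 2 ^ 2 * w := by nlinarith
  have hSbound : (2 / σ) ^ r * (3 / a) ≤ 2 ^ r * 6 * (N : ℝ) ^ ((r : ℝ) / 2 + 1 / 4) := by
    rw [Real.rpow_add hN0, ← hwpow]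
    have h1 : (2 / σ) ^ r ≤ 2 ^ r * w ^ r := by
      rw [← mul_pow]
      apply pow_le_pow_left₀ (by positivity)
      rw [show 2 / σ = 2 * (1 / σ) by ring]
      linarith
    have h2 : 3 / a ≤ 6 * (N : ℝ) ^ ((1 : ℝ) / 4) := by
      rw [show 3 / a = 3 * (1 / a) by ring]; linarith
    calc _ ≤ (2 ^ r * w ^ r) * (6 * (N : ℝ) ^ ((1 : ℝ) / 4)) :=
          mul_le_mul h1 h2 (by positivity) (by positivity)
      _ = _ := by ring
  have hsub : {x : ℝ | 1 / (4 * w) ≤ |x| ∧ |x| ≤ 1 / 2} ⊆ Set.Icc (-(1 / 2)) (1 / 2) := by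
    rintro x ⟨-, hx⟩
    exact abs_le.1 hx
  have hvol : volume (Set.Icc (-(1 / 2) : ℝ) (1 / 2)) = 1 := by
    rw [Real.volume_Icc]; norm_num
  have hfin : volume {x : ℝ | 1 / (4 * w) ≤ |x| ∧ |x| ≤ 1 / 2} ≤ 1 := hvol ▸ measure_mono hsub
  have hreal : volume.real {x : ℝ | 1 / (4 * w) ≤ |x| ∧ |x| ≤ 1 / 2} ≤ 1 := by
    rw [Measure.real]
    exact ENNReal.toReal_le_of_le_ofReal zero_le_one (by simpa using hfin)
  refine (norm_setIntegral_le_of_norm_le_const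
    (C := 2 ^ r * 6 * Real.exp 208 * (N : ℝ) ^ ((r : ℝ) / 2 + 1 / 4) *
      Real.exp (3 * Real.pi * w / 4)) (lt_of_le_of_lt hfin ENNReal.one_lt_top) ?_).trans ?_
  · rintro x ⟨hx1, hx2⟩
    have hq : Complex.exp (-(Real.pi / (2 * w)) + 2 * Real.pi * Complex.I * x) =
        Complex.exp (-((σ : ℂ) - (2 * Real.pi * x : ℝ) * Complex.I)) := by
      congr 1
      rw [hσdef]; push_cast; ring
    rw [hq]
    have habs : |2 * Real.pi * x| = 2 * Real.pi * |x| := by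
      rw [abs_mul, abs_of_pos (by positivity)]
    have hP := aux_P_bound (σ := σ) (θ := 2 * Real.pi * x) hσ (by
      rw [habs]
      calc σ = 2 * Real.pi * (1 / (4 * w)) := by rw [hσdef]; field_simp; norm_num
        _ ≤ _ := mul_le_mul_of_nonneg_left hx1 (by positivity)) (by rw [habs]; nlinarith)
    have hS := aux_Sr r hr (q := Complex.exp (-((σ : ℂ) - (2 * Real.pi * x : ℝ) * Complex.I)))
      hσ hσ1 (by rw [Complex.norm_exp]; simp) ha ha2
    have hE : ‖Complex.exp (-2 * Real.pi * Complex.I * N * x + Real.pi * w / 2)‖ =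
        Real.exp (Real.pi * w / 2) := by
      rw [Complex.norm_exp]
      congr 1
      rw [show (-2 * Real.pi * Complex.I * N * x + Real.pi * w / 2 : ℂ) =
        ((Real.pi * w / 2 : ℝ) : ℂ) + ((-2 * Real.pi * N * x : ℝ) : ℂ) * Complex.I by
          push_cast; ring]
      simp
    rw [norm_mul, hE, SCr, norm_mul]
    rw [hexpo, Real.exp_add] at hP
    calc _ ≤ (Real.exp (Real.pi * w / 4) * Real.exp 208) *
          (2 ^ r * 6 * (N : ℝ) ^ ((r : ℝ) / 2 + 1 / 4)) * Real.exp (Real.pi * w / 2) := by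
          apply mul_le_mul_of_nonneg_right _ (Real.exp_pos _).le
          exact mul_le_mul hP (hS.trans hSbound) (norm_nonneg _) (by positivity)
      _ = _ := by
          rw [show 3 * Real.pi * w / 4 = Real.pi * w / 4 + Real.pi * w / 2 by ring, Real.exp_add]
          ring
  · exact mul_le_of_le_one_right (by positivity) hreal
end

section
/- There is a constant C > 0 such that for all sufficiently large N the following holds: set y = 1/(4√N); then for every real x with |x| ≤ y, writing τ = x + iy and q = e^{2πiτ}, one has |(−q;q)_∞/(q;q)_∞ − √(−iτ/2)·e^{πi/(8τ)}| ≤ C·|√(−iτ/2)·e^{πi/(8τ)}|·e^{−2π√N}. -/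
open scoped BigOperators
open Filter MeasureTheory

/-- The Euler product `∏ (1 - q^(n+1))`. -/
noncomputable def eulerP (q : ℂ) : ℂ := ∏' n : ℕ, (1 - q ^ (n + 1))

lemma eulerP_zero : eulerP 0 = 1 := by simp [eulerP]

lemma eulerP_ne_zero {q : ℂ} (hq : ‖q‖ < 1) : eulerP q ≠ 0 := by
  have h := tprod_one_add_ne_zero_of_summable (f := fun n : ℕ ↦ -q ^ (n + 1)) ?_ ?_
  · simpa [eulerP, sub_eq_add_neg] using h
  · intro i h0
    have h1 : q ^ (i + 1) = 1 := by linear_combination -h0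
    have h2 : ‖q‖ ^ (i + 1) = 1 := by rw [← norm_pow, h1, norm_one]
    have h3 : ‖q‖ ^ (i + 1) < 1 := pow_lt_one₀ (norm_nonneg _) hq (by omega)
    linarith
  · simpa using (summable_nat_add_iff 1).mpr (summable_geometric_of_lt_one (norm_nonneg _) hq)

lemma poch_quot {q : ℂ} (hq : ‖q‖ < 1) :
    poch (-q) q / poch q q = eulerP (q ^ 2) / eulerP q ^ 2 := by
  have h1 : poch q q = eulerP q := by
    simp only [poch, eulerP, pow_succ']
  have hm : Multipliable fun n : ℕ ↦ 1 + q ^ (n + 1) := by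
    apply multipliable_one_add_of_summable (f := fun n ↦ q ^ (n + 1))
    simpa using (summable_nat_add_iff 1).mpr (summable_geometric_of_lt_one (norm_nonneg _) hq)
  have h2 : poch (-q) q = ∏' n : ℕ, (1 + q ^ (n + 1)) := by
    simp only [poch, pow_succ', neg_mul, sub_neg_eq_add]
  have h3 : poch (-q) q * eulerP q = eulerP (q ^ 2) := by
    rw [h2, eulerP, eulerP, ← hm.tprod_mul (ModularForm.multipliable_one_sub_pow hq)]
    congr 1
    ext n
    ring
  have h4 := eulerP_ne_zero hq
  rw [h1, ← h3]
  field_simp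

lemma eta_eq_eulerP (z : ℂ) : ModularForm.eta z =
    Complex.exp (2 * Real.pi * Complex.I * z / 24) *
      eulerP (Complex.exp (2 * Real.pi * Complex.I * z)) := by
  simp [ModularForm.eta, ModularForm.eta_q, eulerP, Function.Periodic.qParam]

lemma norm_exp_lt {z : ℂ} (hz : 0 < z.im) : ‖Complex.exp (2 * Real.pi * Complex.I * z)‖ < 1 :=
  UpperHalfPlane.norm_exp_two_pi_I_lt_one ⟨z, hz⟩

lemma sqrt_identity {t : ℂ} (ht : 0 < t.im) :
    (-Complex.I * t / 2) ^ ((1 : ℂ) / 2) * (Complex.sqrt Complex.I * Complex.sqrt (2 * t)) = t := by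
  set w := -Complex.I * t / 2 with hw
  have hwre : 0 < w.re := by
    have : w.re = t.im / 2 := by simp [hw]
    rw [this]; linarith
  have hw0 : w ≠ 0 := by rintro h; simp [h] at hwre
  have htw : t = 2 * (Complex.I * w) := by
    rw [hw]; linear_combination t * Complex.I_sq
  have hI : Complex.I * w ≠ 0 := mul_ne_zero Complex.I_ne_zero hw0
  have harg : |w.arg| < Real.pi / 2 := by
    rw [Complex.abs_arg_lt_pi_div_two_iff]; left; exact hwre
  have hlog1 : Complex.log (Complex.I * w) = Complex.log Complex.I + Complex.log w := by
    apply Complex.log_mul Complex.I_ne_zero hw0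
    rw [Complex.arg_I]
    rw [abs_lt] at harg
    constructor <;> linarith [Real.pi_pos]
  have h2t : 2 * t = ((4 : ℝ) : ℂ) * (Complex.I * w) := by rw [htw]; push_cast; ring
  have hlog2 : Complex.log (2 * t) = Real.log 4 + (Complex.log Complex.I + Complex.log w) := by
    rw [h2t, Complex.log_ofReal_mul (by norm_num) hI, hlog1]
  have h2t0 : 2 * t ≠ 0 := by rw [h2t]; exact mul_ne_zero (by norm_num) hI
  have hlog4 : (Real.log 4 : ℂ) = 2 * (Real.log 2 : ℂ) := by
    rw [show (4:ℝ) = 2 ^ 2 by norm_num, Real.log_pow]; push_cast; ring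
  rw [Complex.sqrt, Complex.sqrt, Complex.cpow_def_of_ne_zero hw0,
    Complex.cpow_def_of_ne_zero Complex.I_ne_zero, Complex.cpow_def_of_ne_zero h2t0,
    ← Complex.exp_add, ← Complex.exp_add, hlog2, hlog4]
  rw [show Complex.log w * (1 / 2) + (Complex.log Complex.I * 2⁻¹ +
    (2 * (Real.log 2 : ℂ) + (Complex.log Complex.I + Complex.log w)) * 2⁻¹) =
    (Real.log 2 : ℂ) + (Complex.log Complex.I + Complex.log w) by ring,
    Complex.exp_add, Complex.exp_add, Complex.exp_log hw0, Complex.exp_log Complex.I_ne_zero,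
    ← Complex.ofReal_exp, Real.exp_log (by norm_num)]
  rw [htw]; push_cast; ring

lemma eta_S {t : ℂ} (ht : 0 < t.im) :
    Complex.sqrt Complex.I * ModularForm.eta (-1 / t) = Complex.sqrt t * ModularForm.eta t := by
  have h := ModularForm.eta_comp_eq_csqrt_I_inv (show t ∈ UpperHalfPlane.upperHalfPlaneSet from ht)
  simp only [Function.comp, Pi.smul_apply, Pi.mul_apply, smul_eq_mul] at h
  have hs : Complex.sqrt Complex.I ≠ 0 := by simp [Complex.sqrt]
  rw [h]; field_simp

lemma neg_one_div_im {t : ℂ} (ht : 0 < t.im) : 0 < (-1 / t).im := by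
  have h0 : t ≠ 0 := by rintro rfl; simp at ht
  have : (-1 / t).im = t.im / Complex.normSq t := by
    rw [neg_div, one_div, Complex.neg_im, Complex.inv_im]; ring
  rw [this]
  exact div_pos ht (Complex.normSq_pos.mpr h0)

lemma key {t : ℂ} (ht : 0 < t.im) :
    poch (-(Complex.exp (2 * Real.pi * Complex.I * t))) (Complex.exp (2 * Real.pi * Complex.I * t)) /
      poch (Complex.exp (2 * Real.pi * Complex.I * t)) (Complex.exp (2 * Real.pi * Complex.I * t)) =
    (-Complex.I * t / 2) ^ ((1 : ℂ) / 2) * Complex.exp (Real.pi * Complex.I / (8 * t)) *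
      (eulerP (Complex.exp (-Real.pi * Complex.I / t)) /
        eulerP (Complex.exp (-Real.pi * Complex.I / t) ^ 2) ^ 2) := by
  have h0 : t ≠ 0 := by rintro rfl; simp at ht
  have ht2 : 0 < (2 * t).im := by simpa using ht
  have him := neg_one_div_im ht
  have him2 := neg_one_div_im ht2
  have hs : Complex.sqrt Complex.I ≠ 0 := by simp [Complex.sqrt]
  have hst : Complex.sqrt t ^ 2 = t := by
    rw [Complex.sqrt, ← Complex.cpow_nat_mul]; simp
  have e1 := eta_S ht
  have e2 := eta_S ht2
  have hid := sqrt_identity ht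
  rw [poch_quot (norm_exp_lt ht)]
  set S := (-Complex.I * t / 2) ^ ((1 : ℂ) / 2)
  set s := Complex.sqrt Complex.I
  set r := Complex.sqrt (2 * t)
  set v := Complex.sqrt t
  have hr : r ≠ 0 := by rintro h; rw [h] at hid; simp at hid; exact h0 hid.symm
  have hq1 := eulerP_ne_zero (norm_exp_lt ht)
  have hq2 := eulerP_ne_zero (norm_exp_lt him)
  rw [eta_eq_eulerP, eta_eq_eulerP] at e1 e2
  -- names
  set q := Complex.exp (2 * Real.pi * Complex.I * t) with hq
  have a1 : Complex.exp (2 * Real.pi * Complex.I * (2 * t)) = q ^ 2 := by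
    rw [hq, ← Complex.exp_nat_mul]; congr 1; push_cast; ring
  set u := Complex.exp (-Real.pi * Complex.I / t) with hu
  have a2 : Complex.exp (2 * Real.pi * Complex.I * (-1 / (2 * t))) = u := by
    rw [hu]; congr 1; field_simp
  have a3 : Complex.exp (2 * Real.pi * Complex.I * (-1 / t)) = u ^ 2 := by
    rw [hu, ← Complex.exp_nat_mul]; congr 1; push_cast; field_simp
  rw [a3] at hq2
  rw [a3] at e1
  rw [a1, a2] at e2
  set c := Complex.exp (2 * Real.pi * Complex.I * t / 24) with hc
  have b1 : Complex.exp (2 * Real.pi * Complex.I * (2 * t) / 24) = c ^ 2 := by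
    rw [hc, ← Complex.exp_nat_mul]; congr 1; push_cast; ring
  set d := Complex.exp (2 * Real.pi * Complex.I * (-1 / (2 * t)) / 24) with hd
  have b2 : Complex.exp (2 * Real.pi * Complex.I * (-1 / t) / 24) = d ^ 2 := by
    rw [hd, ← Complex.exp_nat_mul]; congr 1; push_cast; field_simp
  have b3 : Complex.exp (Real.pi * Complex.I / (8 * t)) * d ^ 3 = 1 := by
    rw [hd, ← Complex.exp_nat_mul, ← Complex.exp_add, ← Complex.exp_zero]
    congr 1; push_cast; field_simp; norm_num
  rw [b2] at e1
  rw [b1] at e2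
  have hc0 : c ≠ 0 := Complex.exp_ne_zero _
  have hd0 : d ≠ 0 := Complex.exp_ne_zero _
  set X := Complex.exp (Real.pi * Complex.I / (8 * t))
  have hXd : X = 1 / d ^ 3 := by field_simp; exact b3
  rw [hXd]
  have e1' : s ^ 2 * d ^ 4 * eulerP (u ^ 2) ^ 2 = t * c ^ 2 * eulerP q ^ 2 := by
    linear_combination (s * (d ^ 2 * eulerP (u ^ 2)) + v * (c * eulerP q)) * e1
      + (c * eulerP q) ^ 2 * hst
  have goal' : eulerP (q ^ 2) * (d ^ 3 * eulerP (u ^ 2) ^ 2) = S * eulerP u * eulerP q ^ 2 := by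
    apply mul_left_cancel₀ (show s ^ 2 * d * r * c ^ 2 ≠ 0 by positivity)
    linear_combination r * c ^ 2 * eulerP (q ^ 2) * e1' - t * c ^ 2 * eulerP q ^ 2 * e2
      - s * d * c ^ 2 * eulerP q ^ 2 * eulerP u * hid
  rw [div_eq_iff (pow_ne_zero 2 hq1)]
  field_simp
  linear_combination goal'

lemma local_bound : ∃ C : ℝ, 0 < C ∧ ∃ δ : ℝ, 0 < δ ∧ ∀ u : ℂ, ‖u‖ < δ →
    ‖eulerP u / eulerP (u ^ 2) ^ 2 - 1‖ ≤ C * ‖u‖ := by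
  have hP : DifferentiableAt ℂ eulerP 0 :=
    ModularForm.differentiableOn_tprod_one_sub_pow.differentiableAt
      (Metric.isOpen_ball.mem_nhds (by simp))
  have hP2 : DifferentiableAt ℂ (fun u : ℂ ↦ eulerP (u ^ 2)) 0 := by
    apply DifferentiableAt.comp (g := eulerP) (f := fun u : ℂ ↦ u ^ 2)
    · simpa using hP
    · fun_prop
  have hG : DifferentiableAt ℂ (fun u : ℂ ↦ eulerP u / eulerP (u ^ 2) ^ 2) 0 :=
    hP.div (hP2.pow 2) (by simp [eulerP_zero])
  have hO := hG.isBigO_sub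
  obtain ⟨C, hC, hb⟩ := hO.exists_pos
  rw [Asymptotics.isBigOWith_iff, Metric.eventually_nhds_iff] at hb
  obtain ⟨δ, hδ, hb⟩ := hb
  refine ⟨C, hC, δ, hδ, fun u hu ↦ ?_⟩
  have := @hb u (by simpa using hu)
  simpa [eulerP_zero] using this

/-- Asymptotics of the overpartition generating function near `q = 1`. -/
theorem overpartition_genfun_near_pole :
    ∃ C : ℝ, 0 < C ∧ ∃ N₀ : ℕ, ∀ N : ℕ, N₀ ≤ N →
      ∀ x : ℝ, |x| ≤ 1 / (4 * Real.sqrt N) →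
        ‖poch (-(Complex.exp (2 * Real.pi * Complex.I * mkTau x (1 / (4 * Real.sqrt N)))))
              (Complex.exp (2 * Real.pi * Complex.I * mkTau x (1 / (4 * Real.sqrt N)))) /
            poch (Complex.exp (2 * Real.pi * Complex.I * mkTau x (1 / (4 * Real.sqrt N))))
              (Complex.exp (2 * Real.pi * Complex.I * mkTau x (1 / (4 * Real.sqrt N)))) -
            (-Complex.I * mkTau x (1 / (4 * Real.sqrt N)) / 2) ^ ((1 : ℂ) / 2) *
              Complex.exp (Real.pi * Complex.I / (8 * mkTau x (1 / (4 * Real.sqrt N))))‖ ≤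
          C * ‖(-Complex.I * mkTau x (1 / (4 * Real.sqrt N)) / 2) ^ ((1 : ℂ) / 2) *
              Complex.exp (Real.pi * Complex.I / (8 * mkTau x (1 / (4 * Real.sqrt N))))‖ *
            Real.exp (-2 * Real.pi * Real.sqrt N) := by
  obtain ⟨C, hC, δ, hδ, hb⟩ := local_bound
  have hlim : Tendsto (fun N : ℕ ↦ Real.exp (-2 * Real.pi * Real.sqrt N)) atTop (nhds 0) := by
    apply Real.tendsto_exp_atBot.comp
    apply Tendsto.const_mul_atTop_of_neg (by linarith [Real.pi_pos])
    exact Real.tendsto_sqrt_atTop.comp tendsto_natCast_atTop_atTop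
  obtain ⟨N₁, hN₁⟩ := eventually_atTop.mp (hlim.eventually_lt_const hδ)
  refine ⟨C, hC, max N₁ 1, fun N hN x hx ↦ ?_⟩
  have hNpos : 0 < Real.sqrt N := Real.sqrt_pos.mpr (by
    have : 1 ≤ N := le_trans (le_max_right _ _) hN
    exact_mod_cast this)
  set R := Real.sqrt N with hR
  have hsmall := hN₁ N (le_trans (le_max_left _ _) hN)
  rw [← hR] at hsmall
  set y := 1 / (4 * R) with hy
  have hypos : 0 < y := by positivity
  have hre : (mkTau x y).re = x := by simp [mkTau]
  have him : (mkTau x y).im = y := by simp [mkTau]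
  have ht : 0 < (mkTau x y).im := by rw [him]; exact hypos
  rw [key ht]
  set t := mkTau x y
  set M := (-Complex.I * t / 2) ^ ((1 : ℂ) / 2) * Complex.exp (Real.pi * Complex.I / (8 * t))
  set u := Complex.exp (-Real.pi * Complex.I / t) with hu
  have hun : ‖u‖ ≤ Real.exp (-2 * Real.pi * R) := by
    rw [hu, Complex.norm_exp]
    apply Real.exp_le_exp.mpr
    have h1 : (-Real.pi * Complex.I / t).re = -(Real.pi * (y / (x ^ 2 + y ^ 2))) := by
      rw [Complex.div_re, Complex.normSq_apply, hre, him]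
      simp
      ring
    rw [h1]
    have h2 : 2 * R ≤ y / (x ^ 2 + y ^ 2) := by
      have hx2 : x ^ 2 ≤ y ^ 2 := by
        rw [← sq_abs x]; exact pow_le_pow_left₀ (abs_nonneg _) hx 2
      rw [le_div_iff₀ (by positivity)]
      have h3 : 4 * R * y = 1 := by rw [hy]; field_simp
      nlinarith
    nlinarith [Real.pi_pos]
  have hfin := hb u (lt_of_le_of_lt hun hsmall)
  rw [show M * (eulerP u / eulerP (u ^ 2) ^ 2) - M = M * (eulerP u / eulerP (u ^ 2) ^ 2 - 1) by ring,
    norm_mul]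
  calc ‖M‖ * ‖eulerP u / eulerP (u ^ 2) ^ 2 - 1‖ ≤ ‖M‖ * (C * Real.exp (-2 * Real.pi * R)) := by
        gcongr
        exact hfin.trans (by gcongr)
    _ = C * ‖M‖ * Real.exp (-2 * Real.pi * R) := by ring
end
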